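/- arXiv:2310.14375 — 2 statements merged into one kernel-verified Lean document; each statement's English description precedes it below -/
import Mathlib

section
/- Let M, a be reals with 0 ≤ a < M, let g be the Kerr metric on U, and let (e₀,e₁,e₂,e₃) be the canonical tetrad. Define the mean curvature field of the foliation spanned by (e₀,e₁) as H = ½(−P(∇_{e₀}e₀) + P(∇_{e₁}e₁)), where P(v) = g(v,e₂)e₂ + g(v,e₃)e₃, and the dual mean curvature field as H̃ = ½(Q(∇_{e₂}e₂) + Q(∇_{e₃}e₃)), where Q(v) = −g(v,e₀)e₀ + g(v,e₁)e₁. Then the covector field 2(H+H̃)^♭, whose components are 2 g_{μν}(H+H̃)^ν, equals the 1-form −((r−M)/Δ) dr − cotθ dθ, i.e., it has components (0, −(r−M)/Δ, −cotθ, 0) in the coordinates (t,r,θ,φ). -/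
noncomputable section

/-- Partial derivative of `f` in the coordinate direction `μ`,
coordinates `(x 0, x 1, x 2, x 3) = (t, r, θ, φ)`. -/
def pd (μ : Fin 4) (f : (Fin 4 → ℝ) → ℝ) (x : Fin 4 → ℝ) : ℝ :=
  fderiv ℝ f x (Pi.single μ 1)

/-- ρ² = r² + a² cos²θ. -/
def rho2 (a : ℝ) (x : Fin 4 → ℝ) : ℝ := (x 1) ^ 2 + a ^ 2 * Real.cos (x 2) ^ 2

/-- Δ = r² − 2Mr + a². -/
def Del (M a : ℝ) (x : Fin 4 → ℝ) : ℝ := (x 1) ^ 2 - 2 * M * (x 1) + a ^ 2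

/-- Σ² = (r²+a²)² − Δ a² sin²θ. -/
def Sig2 (M a : ℝ) (x : Fin 4 → ℝ) : ℝ :=
  ((x 1) ^ 2 + a ^ 2) ^ 2 - Del M a x * a ^ 2 * Real.sin (x 2) ^ 2

/-- The Kerr metric in Boyer–Lindquist coordinates `(t, r, θ, φ)`. -/
def kerr (M a : ℝ) (x : Fin 4 → ℝ) : Matrix (Fin 4) (Fin 4) ℝ :=
  Matrix.of fun μ ν =>
    if μ = 0 ∧ ν = 0 then -1 + 2 * M * (x 1) / rho2 a x
    else if (μ = 0 ∧ ν = 3) ∨ (μ = 3 ∧ ν = 0) then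
      -(2 * M * (x 1) * a * Real.sin (x 2) ^ 2) / rho2 a x
    else if μ = 1 ∧ ν = 1 then rho2 a x / Del M a x
    else if μ = 2 ∧ ν = 2 then rho2 a x
    else if μ = 3 ∧ ν = 3 then Sig2 M a x * Real.sin (x 2) ^ 2 / rho2 a x
    else 0

/-- The exterior Kerr domain U = {r > r₊, 0 < θ < π}. -/
def KerrExt (M a : ℝ) : Set (Fin 4 → ℝ) :=
  {x | M + Real.sqrt (M ^ 2 - a ^ 2) < x 1 ∧ 0 < x 2 ∧ x 2 < Real.pi}

/-- The canonical tetrad (e₀, e₁, e₂, e₃) in exterior Kerr geometry. -/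
def tetrad (M a : ℝ) : Fin 4 → (Fin 4 → ℝ) → Fin 4 → ℝ :=
  ![fun x μ => (Real.sqrt (rho2 a x * Del M a x))⁻¹ * ![(x 1) ^ 2 + a ^ 2, 0, 0, a] μ,
    fun x μ => (Real.sqrt (rho2 a x) * Real.sin (x 2))⁻¹ *
      ![a * Real.sin (x 2) ^ 2, 0, 0, 1] μ,
    fun x μ => Real.sqrt (Del M a x / rho2 a x) * ![0, 1, 0, 0] μ,
    fun x μ => (Real.sqrt (rho2 a x))⁻¹ * ![0, 0, 1, 0] μ]

/-- Christoffel symbols Γ^λ_{μν} of the Kerr metric. -/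
def chr (M a : ℝ) (lam μ ν : Fin 4) (x : Fin 4 → ℝ) : ℝ :=
  (1 / 2) * ∑ σ : Fin 4, (kerr M a x)⁻¹ lam σ *
    (pd μ (fun y => kerr M a y ν σ) x + pd ν (fun y => kerr M a y μ σ) x
      - pd σ (fun y => kerr M a y μ ν) x)

/-- Covariant derivative (∇_v w)^λ = v^μ ∂_μ w^λ + Γ^λ_{μν} v^μ w^ν. -/
def nab (M a : ℝ) (v w : (Fin 4 → ℝ) → Fin 4 → ℝ) (x : Fin 4 → ℝ) (lam : Fin 4) : ℝ :=
  (∑ μ : Fin 4, v x μ * pd μ (fun y => w y lam) x)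
    + ∑ μ : Fin 4, ∑ ν : Fin 4, chr M a lam μ ν x * v x μ * w x ν

/-- g(v, w) = g_{μν} v^μ w^ν. -/
def gdot (M a : ℝ) (v w : (Fin 4 → ℝ) → Fin 4 → ℝ) (x : Fin 4 → ℝ) : ℝ :=
  ∑ μ : Fin 4, ∑ ν : Fin 4, kerr M a x μ ν * v x μ * w x ν

/-- Mean curvature field H = ½(−P(∇_{e₀}e₀) + P(∇_{e₁}e₁)),
P(v) = g(v,e₂)e₂ + g(v,e₃)e₃. -/
def Hvec (M a : ℝ) (x : Fin 4 → ℝ) (μ : Fin 4) : ℝ :=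
  (1 / 2) *
    (-(gdot M a (nab M a (tetrad M a 0) (tetrad M a 0)) (tetrad M a 2) x * tetrad M a 2 x μ
        + gdot M a (nab M a (tetrad M a 0) (tetrad M a 0)) (tetrad M a 3) x * tetrad M a 3 x μ)
      + (gdot M a (nab M a (tetrad M a 1) (tetrad M a 1)) (tetrad M a 2) x * tetrad M a 2 x μ
        + gdot M a (nab M a (tetrad M a 1) (tetrad M a 1)) (tetrad M a 3) x * tetrad M a 3 x μ))

/-- Dual mean curvature field H̃ = ½(Q(∇_{e₂}e₂) + Q(∇_{e₃}e₃)),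
Q(v) = −g(v,e₀)e₀ + g(v,e₁)e₁. -/
def Htil (M a : ℝ) (x : Fin 4 → ℝ) (μ : Fin 4) : ℝ :=
  (1 / 2) *
    ((-(gdot M a (nab M a (tetrad M a 2) (tetrad M a 2)) (tetrad M a 0) x) * tetrad M a 0 x μ
        + gdot M a (nab M a (tetrad M a 2) (tetrad M a 2)) (tetrad M a 1) x * tetrad M a 1 x μ)
      + (-(gdot M a (nab M a (tetrad M a 3) (tetrad M a 3)) (tetrad M a 0) x) * tetrad M a 0 x μ
        + gdot M a (nab M a (tetrad M a 3) (tetrad M a 3)) (tetrad M a 1) x * tetrad M a 1 x μ))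


/-! ### Partial derivatives -/

lemma pd_of_hasDerivAt {μ : Fin 4} {f : (Fin 4 → ℝ) → ℝ} {x : Fin 4 → ℝ} {d : ℝ}
    (hf : DifferentiableAt ℝ f x)
    (hd : HasDerivAt (fun s => f (Function.update x μ s)) d (x μ)) : pd μ f x = d := by
  have h1 : HasDerivAt (Function.update x μ) (Pi.single μ 1) (x μ) := hasDerivAt_update x μ (x μ)
  have h2 : HasFDerivAt f (fderiv ℝ f x) (Function.update x μ (x μ)) := by
    rw [Function.update_eq_self]; exact hf.hasFDerivAt
  exact (h2.comp_hasDerivAt (x μ) h1).unique hd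

lemma pd_zero (μ : Fin 4) (x : Fin 4 → ℝ) : pd μ (fun _ => (0 : ℝ)) x = 0 := by
  simp [pd]

lemma kerr_diff (M a : ℝ) (x : Fin 4 → ℝ) (hρ : rho2 a x ≠ 0) (hΔ : Del M a x ≠ 0)
    (μ ν : Fin 4) : DifferentiableAt ℝ (fun y => kerr M a y μ ν) x := by
  have d1 : DifferentiableAt ℝ (rho2 a) x := by unfold rho2; fun_prop
  have d2 : DifferentiableAt ℝ (Del M a) x := by unfold Del; fun_prop
  have d3 : DifferentiableAt ℝ (Sig2 M a) x := by unfold Sig2 Del; fun_prop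
  simp only [kerr, Matrix.of_apply]
  split_ifs <;> fun_prop (disch := assumption)

/-- The metric does not depend on `t`. -/
lemma pd_kerr_t (M a : ℝ) (x : Fin 4 → ℝ) (hρ : rho2 a x ≠ 0) (hΔ : Del M a x ≠ 0)
    (μ ν : Fin 4) : pd 0 (fun y => kerr M a y μ ν) x = 0 := by
  apply pd_of_hasDerivAt (kerr_diff M a x hρ hΔ μ ν)
  simp only [kerr, rho2, Del, Sig2, Function.update, Matrix.of_apply]
  simpa using hasDerivAt_const (x 0) _

/-- The metric does not depend on `φ`. -/
lemma pd_kerr_phi (M a : ℝ) (x : Fin 4 → ℝ) (hρ : rho2 a x ≠ 0) (hΔ : Del M a x ≠ 0)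
    (μ ν : Fin 4) : pd 3 (fun y => kerr M a y μ ν) x = 0 := by
  apply pd_of_hasDerivAt (kerr_diff M a x hρ hΔ μ ν)
  simp only [kerr, rho2, Del, Sig2, Function.update, Matrix.of_apply]
  simpa using hasDerivAt_const (x 3) _

lemma hasDerivAt_rho2_r (a : ℝ) (x : Fin 4 → ℝ) :
    HasDerivAt (fun s => rho2 a (Function.update x 1 s)) (2 * x 1) (x 1) := by
  have := ((hasDerivAt_id (x 1)).pow 2).add_const (a ^ 2 * Real.cos (x 2) ^ 2)
  simpa [rho2, Function.update] using this

lemma hasDerivAt_rho2_th (a : ℝ) (x : Fin 4 → ℝ) :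
    HasDerivAt (fun s => rho2 a (Function.update x 2 s))
      (-(2 * a ^ 2 * Real.cos (x 2) * Real.sin (x 2))) (x 2) := by
  have := (((Real.hasDerivAt_cos (x 2)).pow 2).const_mul (a ^ 2)).const_add ((x 1) ^ 2)
  refine (this.congr_deriv ?_).congr_of_eventuallyEq (.of_forall fun s => ?_)
  · simp; ring
  · simp [rho2, Function.update]

lemma hasDerivAt_Sig2_r (M a : ℝ) (x : Fin 4 → ℝ) :
    HasDerivAt (fun s => Sig2 M a (Function.update x 1 s))
      (4 * x 1 * ((x 1) ^ 2 + a ^ 2) - (2 * x 1 - 2 * M) * a ^ 2 * Real.sin (x 2) ^ 2) (x 1) := by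
  have i := hasDerivAt_id (x 1)
  have := (((i.pow 2).add_const (a ^ 2)).pow 2).sub
    (((((i.pow 2).sub (i.const_mul (2 * M))).add_const (a ^ 2)).mul_const (a ^ 2)).mul_const
      (Real.sin (x 2) ^ 2))
  refine (this.congr_deriv ?_).congr_of_eventuallyEq (.of_forall fun s => ?_)
  · simp; ring
  · simp [Sig2, Del, Function.update]

lemma hasDerivAt_Sig2_th (M a : ℝ) (x : Fin 4 → ℝ) :
    HasDerivAt (fun s => Sig2 M a (Function.update x 2 s))
      (-(2 * Del M a x * a ^ 2 * Real.sin (x 2) * Real.cos (x 2))) (x 2) := by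
  have := (((Real.hasDerivAt_sin (x 2)).pow 2).const_mul (Del M a x * a ^ 2)).const_sub
    (((x 1) ^ 2 + a ^ 2) ^ 2)
  refine (this.congr_deriv ?_).congr_of_eventuallyEq (.of_forall fun s => ?_)
  · simp; ring
  · simp [Sig2, Del, Function.update]

lemma pd_r_00 (M a : ℝ) (x : Fin 4 → ℝ) (hρ : rho2 a x ≠ 0) (hΔ : Del M a x ≠ 0) :
    pd 1 (fun y => kerr M a y 0 0) x
      = (2 * M * rho2 a x - 2 * M * x 1 * (2 * x 1)) / rho2 a x ^ 2 := by
  apply pd_of_hasDerivAt (kerr_diff M a x hρ hΔ 0 0)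
  have h := (((hasDerivAt_id (x 1)).const_mul (2 * M)).div (hasDerivAt_rho2_r a x)
    (by simpa using hρ)).const_add (-1)
  refine (h.congr_deriv ?_).congr_of_eventuallyEq (.of_forall fun s => ?_)
  · simp
  · simp [kerr, Function.update]

lemma pd_th_00 (M a : ℝ) (x : Fin 4 → ℝ) (hρ : rho2 a x ≠ 0) (hΔ : Del M a x ≠ 0) :
    pd 2 (fun y => kerr M a y 0 0) x
      = (2 * M * x 1 * (2 * a ^ 2 * Real.cos (x 2) * Real.sin (x 2))) / rho2 a x ^ 2 := by
  apply pd_of_hasDerivAt (kerr_diff M a x hρ hΔ 0 0)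
  have h := ((hasDerivAt_const (x 2) (2 * M * x 1)).div (hasDerivAt_rho2_th a x)
    (by simpa using hρ)).const_add (-1)
  refine (h.congr_deriv ?_).congr_of_eventuallyEq (.of_forall fun s => ?_)
  · simp
  · simp [kerr, Function.update]

lemma pd_r_03 (M a : ℝ) (x : Fin 4 → ℝ) (hρ : rho2 a x ≠ 0) (hΔ : Del M a x ≠ 0) :
    pd 1 (fun y => kerr M a y 0 3) x
      = -((2 * M * rho2 a x - 2 * M * x 1 * (2 * x 1)) * a * Real.sin (x 2) ^ 2)
        / rho2 a x ^ 2 := by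
  apply pd_of_hasDerivAt (kerr_diff M a x hρ hΔ 0 3)
  have h := (((((hasDerivAt_id (x 1)).const_mul (2 * M)).mul_const a).mul_const
    (Real.sin (x 2) ^ 2)).neg).div (hasDerivAt_rho2_r a x) (by simpa using hρ)
  refine (h.congr_deriv ?_).congr_of_eventuallyEq (.of_forall fun s => ?_)
  · simp; ring
  · simp [kerr, Function.update]

lemma pd_th_03 (M a : ℝ) (x : Fin 4 → ℝ) (hρ : rho2 a x ≠ 0) (hΔ : Del M a x ≠ 0) :
    pd 2 (fun y => kerr M a y 0 3) x
      = -(2 * M * x 1 * a * (2 * Real.sin (x 2) * Real.cos (x 2)) * rho2 a x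
          + 2 * M * x 1 * a * Real.sin (x 2) ^ 2 * (2 * a ^ 2 * Real.cos (x 2) * Real.sin (x 2)))
        / rho2 a x ^ 2 := by
  apply pd_of_hasDerivAt (kerr_diff M a x hρ hΔ 0 3)
  have h := ((((Real.hasDerivAt_sin (x 2)).pow 2).const_mul (2 * M * x 1 * a)).neg).div
    (hasDerivAt_rho2_th a x) (by simpa using hρ)
  refine (h.congr_deriv ?_).congr_of_eventuallyEq (.of_forall fun s => ?_)
  · simp; ring
  · simp [kerr, Function.update]

lemma pd_r_33 (M a : ℝ) (x : Fin 4 → ℝ) (hρ : rho2 a x ≠ 0) (hΔ : Del M a x ≠ 0) :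
    pd 1 (fun y => kerr M a y 3 3) x
      = ((4 * x 1 * ((x 1) ^ 2 + a ^ 2) - (2 * x 1 - 2 * M) * a ^ 2 * Real.sin (x 2) ^ 2)
          * Real.sin (x 2) ^ 2 * rho2 a x - Sig2 M a x * Real.sin (x 2) ^ 2 * (2 * x 1))
        / rho2 a x ^ 2 := by
  apply pd_of_hasDerivAt (kerr_diff M a x hρ hΔ 3 3)
  have h := ((hasDerivAt_Sig2_r M a x).mul_const (Real.sin (x 2) ^ 2)).div
    (hasDerivAt_rho2_r a x) (by simpa using hρ)
  refine (h.congr_deriv ?_).congr_of_eventuallyEq (.of_forall fun s => ?_)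
  · simp
  · simp [kerr, Function.update]

lemma pd_th_33 (M a : ℝ) (x : Fin 4 → ℝ) (hρ : rho2 a x ≠ 0) (hΔ : Del M a x ≠ 0) :
    pd 2 (fun y => kerr M a y 3 3) x
      = ((-(2 * Del M a x * a ^ 2 * Real.sin (x 2) * Real.cos (x 2)) * Real.sin (x 2) ^ 2
          + Sig2 M a x * (2 * Real.sin (x 2) * Real.cos (x 2))) * rho2 a x
          + Sig2 M a x * Real.sin (x 2) ^ 2 * (2 * a ^ 2 * Real.cos (x 2) * Real.sin (x 2)))
        / rho2 a x ^ 2 := by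
  apply pd_of_hasDerivAt (kerr_diff M a x hρ hΔ 3 3)
  have h := ((hasDerivAt_Sig2_th M a x).mul ((Real.hasDerivAt_sin (x 2)).pow 2)).div
    (hasDerivAt_rho2_th a x) (by simpa using hρ)
  refine (h.congr_deriv ?_).congr_of_eventuallyEq (.of_forall fun s => ?_)
  · simp
  · simp [kerr, Function.update]

/-! ### Inverse metric -/

lemma kerr_inv (M a : ℝ) (x : Fin 4 → ℝ) (hρ : rho2 a x ≠ 0) (hΔ : Del M a x ≠ 0)
    (hs : Real.sin (x 2) ≠ 0) :
    (kerr M a x)⁻¹ =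
      !![-Sig2 M a x / (rho2 a x * Del M a x), 0, 0, -(2 * M * x 1 * a) / (rho2 a x * Del M a x);
         0, Del M a x / rho2 a x, 0, 0;
         0, 0, 1 / rho2 a x, 0;
         -(2 * M * x 1 * a) / (rho2 a x * Del M a x), 0, 0,
           (Del M a x - a ^ 2 * Real.sin (x 2) ^ 2)
            / (rho2 a x * Del M a x * Real.sin (x 2) ^ 2)] := by
  apply Matrix.inv_eq_right_inv
  have hc : Real.cos (x 2) ^ 2 = 1 - Real.sin (x 2) ^ 2 := by
    rw [← Real.sin_sq_add_cos_sq (x 2)]; ring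
  ext i j
  fin_cases i <;> fin_cases j <;>
    simp [kerr, Matrix.mul_apply, Fin.sum_univ_four] <;> field_simp <;>
    simp only [Sig2, rho2, Del, hc] <;> ring

/-! ### Components of the covariant derivatives -/

lemma kerr_30 (M a : ℝ) : (fun y => kerr M a y 3 0) = fun y => kerr M a y 0 3 := by
  funext y; simp [kerr]

lemma kerr_offdiag (M a : ℝ) (y : Fin 4 → ℝ) :
    kerr M a y 0 1 = 0 ∧ kerr M a y 0 2 = 0 ∧ kerr M a y 1 0 = 0 ∧ kerr M a y 1 2 = 0 ∧
    kerr M a y 1 3 = 0 ∧ kerr M a y 2 0 = 0 ∧ kerr M a y 2 1 = 0 ∧ kerr M a y 2 3 = 0 ∧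
    kerr M a y 3 1 = 0 ∧ kerr M a y 3 2 = 0 := by
  simp [kerr]

/-- `r`-component of the acceleration of a field tangent to the `(t, φ)` directions. -/
lemma nab_r (M a : ℝ) (x : Fin 4 → ℝ) (hρ : rho2 a x ≠ 0) (hΔ : Del M a x ≠ 0)
    (hs : Real.sin (x 2) ≠ 0) (v : (Fin 4 → ℝ) → Fin 4 → ℝ)
    (h1 : ∀ y, v y 1 = 0) (h2 : ∀ y, v y 2 = 0) :
    nab M a v v x 1 = -(1 / 2) * (Del M a x / rho2 a x) *
      (pd 1 (fun y => kerr M a y 0 0) x * v x 0 ^ 2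
        + 2 * pd 1 (fun y => kerr M a y 0 3) x * v x 0 * v x 3
        + pd 1 (fun y => kerr M a y 3 3) x * v x 3 ^ 2) := by
  have ko := kerr_offdiag M a
  simp only [nab, chr, Fin.sum_univ_four, kerr_inv M a x hρ hΔ hs, h1, h2, pd_zero, kerr_30,
    pd_kerr_t M a x hρ hΔ, pd_kerr_phi M a x hρ hΔ, ko]
  simp
  ring

/-- `θ`-component of the acceleration of a field tangent to the `(t, φ)` directions. -/
lemma nab_th (M a : ℝ) (x : Fin 4 → ℝ) (hρ : rho2 a x ≠ 0) (hΔ : Del M a x ≠ 0)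
    (hs : Real.sin (x 2) ≠ 0) (v : (Fin 4 → ℝ) → Fin 4 → ℝ)
    (h1 : ∀ y, v y 1 = 0) (h2 : ∀ y, v y 2 = 0) :
    nab M a v v x 2 = -(1 / 2) * (1 / rho2 a x) *
      (pd 2 (fun y => kerr M a y 0 0) x * v x 0 ^ 2
        + 2 * pd 2 (fun y => kerr M a y 0 3) x * v x 0 * v x 3
        + pd 2 (fun y => kerr M a y 3 3) x * v x 3 ^ 2) := by
  have ko := kerr_offdiag M a
  simp only [nab, chr, Fin.sum_univ_four, kerr_inv M a x hρ hΔ hs, h1, h2, pd_zero, kerr_30,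
    pd_kerr_t M a x hρ hΔ, pd_kerr_phi M a x hρ hΔ, ko]
  simp
  ring

/-- A field tangent to the `(r, θ)` directions has acceleration without `t`, `φ` components. -/
lemma nab_tphi (M a : ℝ) (x : Fin 4 → ℝ) (hρ : rho2 a x ≠ 0) (hΔ : Del M a x ≠ 0)
    (hs : Real.sin (x 2) ≠ 0) (v : (Fin 4 → ℝ) → Fin 4 → ℝ)
    (h1 : ∀ y, v y 0 = 0) (h2 : ∀ y, v y 3 = 0) :
    nab M a v v x 0 = 0 ∧ nab M a v v x 3 = 0 := by
  have ko := kerr_offdiag M a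
  constructor <;>
  · simp only [nab, chr, Fin.sum_univ_four, kerr_inv M a x hρ hΔ hs, h1, h2, pd_zero, kerr_30,
      pd_kerr_t M a x hρ hΔ, pd_kerr_phi M a x hρ hΔ, ko]
    simp

lemma Htil_zero (M a : ℝ) (x : Fin 4 → ℝ) (hρ : rho2 a x ≠ 0) (hΔ : Del M a x ≠ 0)
    (hs : Real.sin (x 2) ≠ 0) (μ : Fin 4) : Htil M a x μ = 0 := by
  have ko := kerr_offdiag M a x
  obtain ⟨p0, p3⟩ := nab_tphi M a x hρ hΔ hs (tetrad M a 2)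
    (by simp [tetrad]) (by simp [tetrad])
  obtain ⟨q0, q3⟩ := nab_tphi M a x hρ hΔ hs (tetrad M a 3)
    (by simp [tetrad]) (by simp [tetrad])
  have z01 : tetrad M a 0 x 1 = 0 := by simp [tetrad]
  have z02 : tetrad M a 0 x 2 = 0 := by simp [tetrad]
  have z11 : tetrad M a 1 x 1 = 0 := by simp [tetrad]
  have z12 : tetrad M a 1 x 2 = 0 := by simp [tetrad]
  simp [Htil, gdot, Fin.sum_univ_four, p0, p3, q0, q3, z01, z02, z11, z12, ko]

/-- `2H` in terms of the acceleration components. -/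
lemma Hvec_eq (M a : ℝ) (x : Fin 4 → ℝ) (hρ : 0 < rho2 a x) (hΔ : 0 < Del M a x) (μ : Fin 4) :
    Hvec M a x μ = (1 / 2) *
      ![0, nab M a (tetrad M a 1) (tetrad M a 1) x 1 - nab M a (tetrad M a 0) (tetrad M a 0) x 1,
        nab M a (tetrad M a 1) (tetrad M a 1) x 2 - nab M a (tetrad M a 0) (tetrad M a 0) x 2,
        0] μ := by
  have ko := kerr_offdiag M a x
  have k11 : kerr M a x 1 1 = rho2 a x / Del M a x := by simp [kerr]
  have k22 : kerr M a x 2 2 = rho2 a x := by simp [kerr]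
  have h1 : Real.sqrt (Del M a x / rho2 a x) ^ 2 = Del M a x / rho2 a x :=
    Real.sq_sqrt (by positivity)
  have h2 : (Real.sqrt (rho2 a x))⁻¹ ^ 2 = (rho2 a x)⁻¹ := by
    rw [inv_pow, Real.sq_sqrt hρ.le]
  have t2 : tetrad M a 2 x = fun μ => Real.sqrt (Del M a x / rho2 a x) * ![0, 1, 0, 0] μ := rfl
  have t3 : tetrad M a 3 x = fun μ => (Real.sqrt (rho2 a x))⁻¹ * ![0, 0, 1, 0] μ := rfl
  simp only [Hvec, gdot, Fin.sum_univ_four, t2, t3, ko, k11, k22]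
  generalize nab M a (tetrad M a 1) (tetrad M a 1) x = n1
  generalize nab M a (tetrad M a 0) (tetrad M a 0) x = n0
  generalize Real.sqrt (Del M a x / rho2 a x) = A at *
  generalize (Real.sqrt (rho2 a x))⁻¹ = B at *
  have e1 : rho2 a x / Del M a x * A ^ 2 = 1 := by rw [h1]; field_simp
  have e2 : rho2 a x * B ^ 2 = 1 := by rw [h2]; field_simp
  fin_cases μ
  · simp
  · simp
    linear_combination (n1 1 - n0 1) * e1
  · simp
    linear_combination (n1 2 - n0 2) * e2
  · simp

/-- 2(H + H̃)^♭ = −((r−M)/Δ) dr − cotθ dθ on U. -/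
theorem kerr_mean_curvature_oneform (M a : ℝ) (ha : 0 ≤ a) (haM : a < M) :
    ∀ x ∈ KerrExt M a, ∀ μ : Fin 4,
      2 * (∑ ν : Fin 4, kerr M a x μ ν * (Hvec M a x ν + Htil M a x ν))
        = ![0, -((x 1) - M) / Del M a x, -(Real.cos (x 2) / Real.sin (x 2)), 0] μ := by
  intro x hx μ
  obtain ⟨hr, hθ0, hθπ⟩ := hx
  have hs : 0 < Real.sin (x 2) := Real.sin_pos_of_pos_of_lt_pi hθ0 hθπ
  have hsq : 0 ≤ M ^ 2 - a ^ 2 := by nlinarith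
  have hq := Real.sqrt_nonneg (M ^ 2 - a ^ 2)
  have hq2 := Real.sq_sqrt hsq
  have hrpos : 0 < x 1 := by linarith
  have hρ : 0 < rho2 a x := by unfold rho2; positivity
  have hΔ : 0 < Del M a x := by unfold Del; nlinarith
  have hρ' := hρ.ne'
  have hΔ' := hΔ.ne'
  have hs' := hs.ne'
  have hc : Real.cos (x 2) ^ 2 = 1 - Real.sin (x 2) ^ 2 := by
    rw [← Real.sin_sq_add_cos_sq (x 2)]; ring
  have ko := kerr_offdiag M a x
  have k11 : kerr M a x 1 1 = rho2 a x / Del M a x := by simp [kerr]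
  have k22 : kerr M a x 2 2 = rho2 a x := by simp [kerr]
  have z01 : ∀ y, tetrad M a 0 y 1 = 0 := by simp [tetrad]
  have z02 : ∀ y, tetrad M a 0 y 2 = 0 := by simp [tetrad]
  have z11 : ∀ y, tetrad M a 1 y 1 = 0 := by simp [tetrad]
  have z12 : ∀ y, tetrad M a 1 y 2 = 0 := by simp [tetrad]
  have hS : (Real.sqrt (rho2 a x * Del M a x)) ^ 2 = rho2 a x * Del M a x :=
    Real.sq_sqrt (by positivity)
  have hR : (Real.sqrt (rho2 a x)) ^ 2 = rho2 a x := Real.sq_sqrt hρ.le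
  -- contractions of the tetrad
  have c00 : tetrad M a 1 x 0 ^ 2 - tetrad M a 0 x 0 ^ 2
      = -Sig2 M a x / (rho2 a x * Del M a x) := by
    simp [tetrad, mul_pow, hS, hR]
    field_simp
    simp only [Sig2]; ring
  have c03 : tetrad M a 1 x 0 * tetrad M a 1 x 3 - tetrad M a 0 x 0 * tetrad M a 0 x 3
      = -(2 * M * x 1 * a) / (rho2 a x * Del M a x) := by
    have e1 : tetrad M a 1 x 0 * tetrad M a 1 x 3
        = a * Real.sin (x 2) ^ 2 / (Real.sqrt (rho2 a x) ^ 2 * Real.sin (x 2) ^ 2) := by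
      simp [tetrad]; field_simp
    have e0 : tetrad M a 0 x 0 * tetrad M a 0 x 3
        = (x 1 ^ 2 + a ^ 2) * a / (Real.sqrt (rho2 a x * Del M a x) ^ 2) := by
      simp only [tetrad]; simp [-Real.sqrt_mul', -Real.sqrt_mul]; ring
    rw [e1, e0, hS, hR]
    field_simp
    simp only [Del]; ring
  have c33 : tetrad M a 1 x 3 ^ 2 - tetrad M a 0 x 3 ^ 2
      = (Del M a x - a ^ 2 * Real.sin (x 2) ^ 2)
            / (rho2 a x * Del M a x * Real.sin (x 2) ^ 2) := by
    simp [tetrad, mul_pow, hS, hR]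
    field_simp
  simp only [Htil_zero M a x hρ' hΔ' hs', Hvec_eq M a x hρ hΔ, Fin.sum_univ_four]
  fin_cases μ
  · simp [ko]
  · simp only [nab_r M a x hρ' hΔ' hs' _ z01 z02, nab_r M a x hρ' hΔ' hs' _ z11 z12]
    simp [ko, k11]
    trans -(1 / 2) * (pd 1 (fun y => kerr M a y 0 0) x
            * (tetrad M a 1 x 0 ^ 2 - tetrad M a 0 x 0 ^ 2)
        + 2 * pd 1 (fun y => kerr M a y 0 3) x
            * (tetrad M a 1 x 0 * tetrad M a 1 x 3 - tetrad M a 0 x 0 * tetrad M a 0 x 3)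
        + pd 1 (fun y => kerr M a y 3 3) x * (tetrad M a 1 x 3 ^ 2 - tetrad M a 0 x 3 ^ 2))
    · field_simp; ring
    rw [c00, c03, c33, pd_r_00 M a x hρ' hΔ', pd_r_03 M a x hρ' hΔ', pd_r_33 M a x hρ' hΔ']
    field_simp
    simp only [Sig2, rho2, Del, hc]
    ring
  · simp only [nab_th M a x hρ' hΔ' hs' _ z01 z02, nab_th M a x hρ' hΔ' hs' _ z11 z12]
    simp [ko, k22]
    trans -(1 / 2) * (pd 2 (fun y => kerr M a y 0 0) x
            * (tetrad M a 1 x 0 ^ 2 - tetrad M a 0 x 0 ^ 2)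
        + 2 * pd 2 (fun y => kerr M a y 0 3) x
            * (tetrad M a 1 x 0 * tetrad M a 1 x 3 - tetrad M a 0 x 0 * tetrad M a 0 x 3)
        + pd 2 (fun y => kerr M a y 3 3) x * (tetrad M a 1 x 3 ^ 2 - tetrad M a 0 x 3 ^ 2))
    · field_simp; ring
    rw [c00, c03, c33, pd_th_00 M a x hρ' hΔ', pd_th_03 M a x hρ' hΔ', pd_th_33 M a x hρ' hΔ']
    field_simp
    simp only [Sig2, rho2, Del, hc]
    ring
  · simp [ko]
end
end

section
/- Let M, a be reals with 0 ≤ a < M and let u₀ be a real constant. On U, the 2-form F₁ = u₀ (ρ²/(sinθ Δ)) dr ∧ dθ and the 2-form F₂ = u₀ dt ∧ dφ are each closed and have identically vanishing current density (j^μ = 0 for all μ); i.e., F₁ and F₂ are vacuum solutions of Maxwell's equations in the exterior Kerr geometry. -/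
noncomputable section

/-- `wedge μ ν f` is the antisymmetric matrix of the 2-form `f dx^μ ∧ dx^ν`. -/
def wedge (μ ν : Fin 4) (f : ℝ) : Matrix (Fin 4) (Fin 4) ℝ :=
  Matrix.of fun i j => if i = μ ∧ j = ν then f else if i = ν ∧ j = μ then -f else 0

/-- A 2-form `F` is closed on `S`: ∂_μ F_{νλ} + ∂_ν F_{λμ} + ∂_λ F_{μν} = 0. -/
def Closed2Form (F : (Fin 4 → ℝ) → Matrix (Fin 4) (Fin 4) ℝ) (S : Set (Fin 4 → ℝ)) : Prop :=
  ∀ x ∈ S, ∀ μ ν lam : Fin 4,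
    pd μ (fun y => F y ν lam) x + pd ν (fun y => F y lam μ) x
      + pd lam (fun y => F y μ ν) x = 0

/-- Current density j^μ = (ρ²sinθ)⁻¹ ∂_ν (ρ²sinθ g^{μα} g^{νβ} F_{αβ}). -/
def current (M a : ℝ) (F : (Fin 4 → ℝ) → Matrix (Fin 4) (Fin 4) ℝ)
    (x : Fin 4 → ℝ) (μ : Fin 4) : ℝ :=
  (rho2 a x * Real.sin (x 2))⁻¹ *
    ∑ ν : Fin 4, pd ν (fun y => rho2 a y * Real.sin (y 2) *
      ∑ i : Fin 4, ∑ j : Fin 4, (kerr M a y)⁻¹ μ i * (kerr M a y)⁻¹ ν j * F y i j) x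

/-- `F` is force-free on `S`: F_{μν} j^ν = 0 for the current density `j` of `F`. -/
def ForceFree (M a : ℝ) (F : (Fin 4 → ℝ) → Matrix (Fin 4) (Fin 4) ℝ)
    (S : Set (Fin 4 → ℝ)) : Prop :=
  ∀ x ∈ S, ∀ μ : Fin 4, ∑ ν : Fin 4, F x μ ν * current M a F x ν = 0

/-- F₁ = u₀ (ρ²/(sinθ Δ)) dr ∧ dθ. -/
def F1 (M a u₀ : ℝ) (x : Fin 4 → ℝ) : Matrix (Fin 4) (Fin 4) ℝ :=
  wedge 1 2 (u₀ * rho2 a x / (Real.sin (x 2) * Del M a x))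

/-- F₂ = u₀ dt ∧ dφ. -/
def F2 (u₀ : ℝ) (_x : Fin 4 → ℝ) : Matrix (Fin 4) (Fin 4) ℝ :=
  wedge 0 3 u₀

/-- A function invariant under translation in the coordinate `μ` has zero partial derivative. -/
theorem pd_eq_zero_of_inv (μ : Fin 4) (f : (Fin 4 → ℝ) → ℝ) (x : Fin 4 → ℝ)
    (h : ∀ t : ℝ, f (x + t • Pi.single μ 1) = f x) : pd μ f x = 0 := by
  unfold pd
  by_cases hf : DifferentiableAt ℝ f x
  · rw [← hf.lineDeriv_eq_fderiv]
    unfold lineDeriv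
    simp only [h]
    simp
  · rw [fderiv_zero_of_not_differentiableAt hf]; simp

theorem pd_congr_on {S : Set (Fin 4 → ℝ)} (hS : IsOpen S) {x : Fin 4 → ℝ} (hx : x ∈ S)
    (μ : Fin 4) {f g : (Fin 4 → ℝ) → ℝ} (h : ∀ y ∈ S, f y = g y) : pd μ f x = pd μ g x := by
  unfold pd
  have : f =ᶠ[nhds x] g := by
    filter_upwards [hS.mem_nhds hx] with y hy using h y hy
  rw [this.fderiv_eq]

theorem pd_const (μ : Fin 4) (c : ℝ) (x : Fin 4 → ℝ) : pd μ (fun _ => c) x = 0 := by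
  simp [pd]

theorem isOpen_ext (M a : ℝ) : IsOpen (KerrExt M a) := by
  unfold KerrExt
  exact (isOpen_lt continuous_const (continuous_apply 1)).inter
    ((isOpen_lt continuous_const (continuous_apply 2)).inter
      (isOpen_lt (continuous_apply 2) continuous_const))

theorem ext_pos {M a : ℝ} (ha : 0 ≤ a) (haM : a < M) {x : Fin 4 → ℝ} (hx : x ∈ KerrExt M a) :
    0 < rho2 a x ∧ 0 < Del M a x ∧ 0 < Real.sin (x 2) := by
  obtain ⟨h1, h2, h3⟩ := hx
  have hs := Real.sqrt_nonneg (M ^ 2 - a ^ 2)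
  have hq : Real.sqrt (M ^ 2 - a ^ 2) ^ 2 = M ^ 2 - a ^ 2 := Real.sq_sqrt (by nlinarith)
  refine ⟨?_, ?_, Real.sin_pos_of_pos_of_lt_pi h2 h3⟩
  · have : 0 < x 1 := by linarith
    unfold rho2; positivity
  · unfold Del; nlinarith

/-- The explicit inverse Kerr metric. -/
def kinv (M a : ℝ) (x : Fin 4 → ℝ) : Matrix (Fin 4) (Fin 4) ℝ :=
  !![-(Sig2 M a x) / (rho2 a x * Del M a x), 0, 0, -(2 * M * x 1 * a) / (rho2 a x * Del M a x);
    0, Del M a x / rho2 a x, 0, 0;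
    0, 0, (rho2 a x)⁻¹, 0;
    -(2 * M * x 1 * a) / (rho2 a x * Del M a x), 0, 0,
      (Del M a x - a ^ 2 * Real.sin (x 2) ^ 2) / (rho2 a x * Del M a x * Real.sin (x 2) ^ 2)]

theorem kerr_inv_s5 {M a : ℝ} (ha : 0 ≤ a) (haM : a < M) {x : Fin 4 → ℝ} (hx : x ∈ KerrExt M a) :
    (kerr M a x)⁻¹ = kinv M a x := by
  obtain ⟨hr, hd, hs⟩ := ext_pos ha haM hx
  have hr' := hr.ne'
  have hd' := hd.ne'
  have hs' := hs.ne'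
  have er : rho2 a x = Del M a x + 2 * M * x 1 - a ^ 2 * Real.sin (x 2) ^ 2 := by
    unfold rho2 Del; rw [Real.cos_sq']; ring
  have eS : Sig2 M a x = (Del M a x + 2 * M * x 1) ^ 2
      - Del M a x * a ^ 2 * Real.sin (x 2) ^ 2 := by
    unfold Sig2 Del; ring
  apply Matrix.inv_eq_right_inv
  ext i j
  fin_cases i <;> fin_cases j <;>
    simp [kerr, kinv, Matrix.mul_apply, Fin.sum_univ_four] <;>
    field_simp <;> (try rw [eS]) <;> generalize Del M a x = D at * <;>
    (try rw [er]) <;> ring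

theorem F1_raised {M a u₀ : ℝ} (ha : 0 ≤ a) (haM : a < M) (μ ν : Fin 4) :
    ∀ y ∈ KerrExt M a, rho2 a y * Real.sin (y 2) *
      ∑ i : Fin 4, ∑ j : Fin 4, (kerr M a y)⁻¹ μ i * (kerr M a y)⁻¹ ν j * F1 M a u₀ y i j
      = wedge 1 2 u₀ μ ν := by
  intro y hy
  obtain ⟨hr, hd, hs⟩ := ext_pos ha haM hy
  have hr' := hr.ne'
  have hd' := hd.ne'
  have hs' := hs.ne'
  rw [kerr_inv_s5 ha haM hy]
  fin_cases μ <;> fin_cases ν <;>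
    simp [kinv, F1, wedge, Fin.sum_univ_four] <;> field_simp

theorem F2_raised {M a u₀ : ℝ} (ha : 0 ≤ a) (haM : a < M) (μ ν : Fin 4) :
    ∀ y ∈ KerrExt M a, rho2 a y * Real.sin (y 2) *
      ∑ i : Fin 4, ∑ j : Fin 4, (kerr M a y)⁻¹ μ i * (kerr M a y)⁻¹ ν j * F2 u₀ y i j
      = wedge 0 3 (rho2 a y * Real.sin (y 2) * u₀ *
          (kinv M a y 0 0 * kinv M a y 3 3 - kinv M a y 0 3 ^ 2)) μ ν := by
  intro y hy
  rw [kerr_inv_s5 ha haM hy]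
  fin_cases μ <;> fin_cases ν <;>
    simp [kinv, F2, wedge, Fin.sum_univ_four] <;>
    first | ring1 | (right; ring1)

/-- F₁ and F₂ are closed with vanishing current density, i.e. they are
vacuum solutions of Maxwell's equations in exterior Kerr geometry. -/
theorem kerr_F1_F2_vacuum (M a u₀ : ℝ) (ha : 0 ≤ a) (haM : a < M) :
    (Closed2Form (F1 M a u₀) (KerrExt M a) ∧
      ∀ x ∈ KerrExt M a, ∀ μ : Fin 4, current M a (F1 M a u₀) x μ = 0) ∧
    (Closed2Form (F2 u₀) (KerrExt M a) ∧
      ∀ x ∈ KerrExt M a, ∀ μ : Fin 4, current M a (F2 u₀) x μ = 0) := by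
  refine ⟨⟨?_, ?_⟩, ?_, ?_⟩
  · intro x _ μ ν lam
    have key : ∀ k i j : Fin 4, (k = 0 ∨ k = 3 ∨ ¬ ((i = 1 ∧ j = 2) ∨ (i = 2 ∧ j = 1))) →
        pd k (fun y => F1 M a u₀ y i j) x = 0 := by
      intro k i j h
      apply pd_eq_zero_of_inv
      intro t
      rcases h with rfl | rfl | h
      · simp [F1, rho2, Del]
      · simp [F1, rho2, Del]
      · rw [not_or] at h
        simp [F1, wedge, h.1, h.2]
    have anti : ∀ k : Fin 4, pd k (fun y => F1 M a u₀ y 2 1) x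
        = - pd k (fun y => F1 M a u₀ y 1 2) x := by
      intro k
      have : (fun y => F1 M a u₀ y 2 1) = fun y => - F1 M a u₀ y 1 2 := by
        funext y; simp [F1, wedge]
      rw [this]; simp [pd, fderiv_fun_neg]
    fin_cases μ <;> fin_cases ν <;> fin_cases lam <;>
      simp [key, anti]
  · intro x hx μ
    unfold current
    rw [Finset.sum_eq_zero, mul_zero]
    intro ν _
    rw [pd_congr_on (isOpen_ext M a) hx ν (F1_raised ha haM μ ν), pd_const]
  · intro x _ μ ν lam
    simp only [F2, pd_const, add_zero]
  · intro x hx μ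
    unfold current
    rw [Finset.sum_eq_zero, mul_zero]
    intro ν _
    rw [pd_congr_on (isOpen_ext M a) hx ν (F2_raised ha haM μ ν)]
    apply pd_eq_zero_of_inv
    intro t
    fin_cases ν <;> simp [wedge, kinv, rho2, Del, Sig2]
end
end
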